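/- Let A be a symmetric positive definite n×n matrix with splitting A = M - N where M is invertible and M + Mᵀ - A is positive definite. If θ ~ N(μ, A⁻¹) with μ = A⁻¹f, and ξ ~ N(0, M + Mᵀ - A) is independent of θ, then θ' := θ + M⁻¹(f + ξ - Aθ) satisfies θ' ~ N(μ, A⁻¹). That is, the random smoother leaves the target Gaussian distribution invariant. -/

import Mathlib

open Matrix MeasureTheory ProbabilityTheory

/-- A measure `μ` on `ℝⁿ` is the Gaussian law `N(m, S)`, characterised by its
characteristic function. -/
def IsGaussianLaw {n : ℕ} (μ : Measure (Fin n → ℝ)) (m : Fin n → ℝ)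
    (S : Matrix (Fin n) (Fin n) ℝ) : Prop :=
  IsProbabilityMeasure μ ∧
    ∀ t : Fin n → ℝ,
      ∫ x, Complex.exp (Complex.I * ((t ⬝ᵥ x : ℝ) : ℂ)) ∂μ
        = Complex.exp (Complex.I * ((t ⬝ᵥ m : ℝ) : ℂ) - ((t ⬝ᵥ S.mulVec t : ℝ) : ℂ) / 2)

/-- Invariance of the target Gaussian under the random smoother: if
`A = M - N` is symmetric positive definite with `M` invertible and `M + Mᵀ - A` positive
definite, `θ ~ N(A⁻¹ f, A⁻¹)` and `ξ ~ N(0, M + Mᵀ - A)` are independent, then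
`θ' = θ + M⁻¹ (f + ξ - A θ)` satisfies `θ' ~ N(A⁻¹ f, A⁻¹)`. -/
theorem random_smoother_invariance {n : ℕ} {Ω : Type*} [MeasurableSpace Ω]
    (P : Measure Ω) [IsProbabilityMeasure P]
    (A M N : Matrix (Fin n) (Fin n) ℝ) (f : Fin n → ℝ)
    (hA : A.PosDef) (hAs : A.IsSymm) (hMN : A = M - N) (hM : IsUnit M.det)
    (hcov : (M + Mᵀ - A).PosDef)
    (θ ξ : Ω → Fin n → ℝ) (hθm : Measurable θ) (hξm : Measurable ξ)
    (hind : IndepFun θ ξ P)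
    (hθ : IsGaussianLaw (Measure.map θ P) (A⁻¹.mulVec f) A⁻¹)
    (hξ : IsGaussianLaw (Measure.map ξ P) 0 (M + Mᵀ - A)) :
    IsGaussianLaw
      (Measure.map (fun ω => θ ω + M⁻¹.mulVec (f + ξ ω - A.mulVec (θ ω))) P)
      (A⁻¹.mulVec f) A⁻¹ := by
  obtain ⟨_, hθ⟩ := hθ
  obtain ⟨_, hξ⟩ := hξ
  have hmeas : Measurable (fun ω => θ ω + M⁻¹.mulVec (f + ξ ω - A.mulVec (θ ω))) := by
    have hc : ∀ B : Matrix (Fin n) (Fin n) ℝ, Measurable (fun x : Fin n → ℝ => B *ᵥ x) :=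
      fun B => (Continuous.matrix_mulVec continuous_const continuous_id).measurable
    exact hθm.add ((hc _).comp ((measurable_const.add hξm).sub ((hc _).comp hθm)))
  have hcont : ∀ t : Fin n → ℝ, Continuous
      (fun x : Fin n → ℝ => Complex.exp (Complex.I * ((t ⬝ᵥ x : ℝ) : ℂ))) := by
    intro t
    have : Continuous (fun x : Fin n → ℝ => t ⬝ᵥ x) :=
      Continuous.dotProduct continuous_const continuous_id
    fun_prop
  refine ⟨Measure.isProbabilityMeasure_map hmeas.aemeasurable, fun t => ?_⟩
  have hAd : IsUnit A.det := hA.det_pos.ne'.isUnit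
  obtain ⟨s, rfl⟩ : ∃ s, Mᵀ *ᵥ s = t :=
    ⟨(Mᵀ)⁻¹ *ᵥ t, by
      rw [mulVec_mulVec, mul_nonsing_inv _ (by rwa [det_transpose]), one_mulVec]⟩
  have hAT : ∀ x y : Fin n → ℝ, (A *ᵥ x) ⬝ᵥ y = x ⬝ᵥ A *ᵥ y := by
    intro x y
    rw [dotProduct_mulVec, ← mulVec_transpose, hAs.eq]
  have hMT : ∀ x y : Fin n → ℝ, (Mᵀ *ᵥ x) ⬝ᵥ y = x ⬝ᵥ M *ᵥ y := by
    intro x y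
    rw [dotProduct_mulVec, ← mulVec_transpose]
  have hAi : ∀ x : Fin n → ℝ, A *ᵥ (A⁻¹ *ᵥ x) = x := by
    intro x
    rw [mulVec_mulVec, mul_nonsing_inv _ hAd, one_mulVec]
  have hAi' : ∀ x : Fin n → ℝ, A⁻¹ *ᵥ (A *ᵥ x) = x := by
    intro x
    rw [mulVec_mulVec, nonsing_inv_mul _ hAd, one_mulVec]
  have hMi : ∀ x : Fin n → ℝ, M *ᵥ (M⁻¹ *ᵥ x) = x := by
    intro x
    rw [mulVec_mulVec, mul_nonsing_inv _ hM, one_mulVec]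
  set r : Fin n → ℝ := Mᵀ *ᵥ s - A *ᵥ s with hr
  have hsplit : ∀ ω, (Mᵀ *ᵥ s) ⬝ᵥ (θ ω + M⁻¹ *ᵥ (f + ξ ω - A *ᵥ θ ω))
      = s ⬝ᵥ f + (r ⬝ᵥ θ ω + s ⬝ᵥ ξ ω) := by
    intro ω
    rw [dotProduct_add, hMT s (M⁻¹ *ᵥ _), hMi, hr, sub_dotProduct, hAT, dotProduct_sub,
      dotProduct_add]
    ring
  have h1 : r ⬝ᵥ A⁻¹ *ᵥ f = (Mᵀ *ᵥ s) ⬝ᵥ A⁻¹ *ᵥ f - s ⬝ᵥ f := by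
    rw [hr, sub_dotProduct, hAT, hAi]
  have h2 : r ⬝ᵥ A⁻¹ *ᵥ r + s ⬝ᵥ (M + Mᵀ - A) *ᵥ s
      = (Mᵀ *ᵥ s) ⬝ᵥ A⁻¹ *ᵥ (Mᵀ *ᵥ s) := by
    have e1 : A⁻¹ *ᵥ r = A⁻¹ *ᵥ (Mᵀ *ᵥ s) - s := by
      rw [hr, mulVec_sub, hAi']
    have e2 : (Mᵀ *ᵥ s) ⬝ᵥ s = s ⬝ᵥ Mᵀ *ᵥ s := dotProduct_comm _ _
    have e3 := hMT s s
    rw [e1, hr, sub_dotProduct, dotProduct_sub, dotProduct_sub, hAT, hAT, hAi, sub_mulVec,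
      add_mulVec, dotProduct_sub, dotProduct_add]
    linarith
  have hI : IndepFun (fun ω => Complex.exp (Complex.I * ((r ⬝ᵥ θ ω : ℝ) : ℂ)))
      (fun ω => Complex.exp (Complex.I * ((s ⬝ᵥ ξ ω : ℝ) : ℂ))) P :=
    hind.comp (hcont r).measurable (hcont s).measurable
  have hθr := hθ r
  have hξs := hξ s
  rw [integral_map hθm.aemeasurable (hcont r).aestronglyMeasurable] at hθr
  rw [integral_map hξm.aemeasurable (hcont s).aestronglyMeasurable] at hξs
  rw [integral_map hmeas.aemeasurable (hcont _).aestronglyMeasurable]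
  simp_rw [hsplit]
  have hfac : ∀ ω, Complex.exp (Complex.I * ((s ⬝ᵥ f + (r ⬝ᵥ θ ω + s ⬝ᵥ ξ ω) : ℝ) : ℂ))
      = Complex.exp (Complex.I * ((s ⬝ᵥ f : ℝ) : ℂ)) *
        (Complex.exp (Complex.I * ((r ⬝ᵥ θ ω : ℝ) : ℂ)) *
          Complex.exp (Complex.I * ((s ⬝ᵥ ξ ω : ℝ) : ℂ))) := by
    intro ω
    rw [← Complex.exp_add, ← Complex.exp_add]
    push_cast
    ring_nf
  simp_rw [hfac]
  rw [integral_const_mul, hI.integral_fun_mul_eq_mul_integral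
    (((hcont r).measurable.comp hθm).aestronglyMeasurable)
    (((hcont s).measurable.comp hξm).aestronglyMeasurable), hθr, hξs, h1, ← h2,
    ← Complex.exp_add, ← Complex.exp_add, dotProduct_zero]
  push_cast
  ring_nf
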